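/- For any θ, θ̃ ∈ Θ_p(s1, s2) and any classification rule Ĝ: if L_θ(G*_{θ̃}) + L_θ(Ĝ) + √(KL(P_θ, P_{θ̃})/2) ≤ 1/2, then L_θ(G*_{θ̃}) − L_θ(Ĝ) − √(KL(P_θ, P_{θ̃})/2) ≤ L_{θ̃}(Ĝ) ≤ L_θ(G*_{θ̃}) + L_θ(Ĝ) + √(KL(P_θ, P_{θ̃})/2). -/

import Mathlib

open MeasureTheory Matrix Real Filter Finset
open scoped ENNReal NNReal BigOperators Kronecker

noncomputable section

/-- The Euclidean (ℓ₂) norm of a finitely indexed real vector. -/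
def l2norm {ι : Type*} [Fintype ι] (v : ι → ℝ) : ℝ := Real.sqrt (∑ i, (v i) ^ 2)

/-- The ℓ₁ norm of a finitely indexed real vector. -/
def l1norm {ι : Type*} [Fintype ι] (v : ι → ℝ) : ℝ := ∑ i, |v i|

/-- The ℓ∞ (sup) norm of a finitely indexed real vector. -/
def linfnorm {ι : Type*} [Fintype ι] (v : ι → ℝ) : ℝ := ⨆ i, |v i|

/-- The Frobenius norm of a square matrix. -/
def frobNorm {p : ℕ} (M : Matrix (Fin p) (Fin p) ℝ) : ℝ :=
  Real.sqrt (∑ i, ∑ j, (M i j) ^ 2)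

/-- The entrywise ℓ₁ norm of a matrix. -/
def matL1 {p : ℕ} (M : Matrix (Fin p) (Fin p) ℝ) : ℝ := ∑ i, ∑ j, |M i j|

/-- The entrywise sup-norm of a matrix. -/
def matLinf {p : ℕ} (M : Matrix (Fin p) (Fin p) ℝ) : ℝ := ⨆ i, ⨆ j, |M i j|

/-- Density of the `N_p(μ, S)` multivariate Gaussian distribution. -/
def gaussPdf (p : ℕ) (μ : Fin p → ℝ) (S : Matrix (Fin p) (Fin p) ℝ) (x : Fin p → ℝ) : ℝ :=
  (2 * Real.pi) ^ (-(p : ℝ) / 2) * S.det ^ (-(1 : ℝ) / 2) *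
    Real.exp (-(1 / 2) * ((x - μ) ⬝ᵥ S⁻¹.mulVec (x - μ)))

/-- The `N_p(μ, S)` multivariate Gaussian measure on `Fin p → ℝ`. -/
def gaussMeasure (p : ℕ) (μ : Fin p → ℝ) (S : Matrix (Fin p) (Fin p) ℝ) :
    Measure (Fin p → ℝ) :=
  volume.withDensity fun x => ENNReal.ofReal (gaussPdf p μ S x)

/-- Kullback–Leibler divergence `KL(μ, ν) = ∫ log (dμ/dν) dμ`. -/
def klDivergence {α : Type*} [MeasurableSpace α] (μ ν : Measure α) : ℝ :=
  ∫ x, Real.log ((μ.rnDeriv ν x).toReal) ∂μ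

/-- The parameter `θ = (π₁, π₂, μ₁, μ₂, Σ₁, Σ₂)` of the two-group QDA model. -/
structure QDAParam (p : ℕ) where
  prior1 : ℝ
  prior2 : ℝ
  mu1 : Fin p → ℝ
  mu2 : Fin p → ℝ
  cov1 : Matrix (Fin p) (Fin p) ℝ
  cov2 : Matrix (Fin p) (Fin p) ℝ

namespace QDAParam

variable {p : ℕ} (θ : QDAParam p)

/-- The differential graph `D = Ω₂ - Ω₁ = Σ₂⁻¹ - Σ₁⁻¹`. -/
def Dmat : Matrix (Fin p) (Fin p) ℝ := θ.cov2⁻¹ - θ.cov1⁻¹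

/-- The discriminating direction `β = Ω₂ δ = Σ₂⁻¹ (μ₂ - μ₁)`. -/
def beta : Fin p → ℝ := θ.cov2⁻¹.mulVec (θ.mu2 - θ.mu1)

/-- The QDA discriminant function `Q(z; θ)`. -/
def Qdisc (z : Fin p → ℝ) : ℝ :=
  (z - θ.mu1) ⬝ᵥ θ.Dmat.mulVec (z - θ.mu1)
    - 2 * (θ.beta ⬝ᵥ (z - (1 / 2 : ℝ) • (θ.mu1 + θ.mu2)))
    - Real.log (θ.cov1.det / θ.cov2.det) + 2 * Real.log (θ.prior1 / θ.prior2)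

/-- The oracle QDA rule `G*_θ(z) = 1 + 1{Q(z; θ) ≤ 0}` with labels in `{1, 2}`. -/
def oracle (z : Fin p → ℝ) : ℕ := if θ.Qdisc z ≤ 0 then 2 else 1

/-- The mixture distribution `π₁ N_p(μ₁, Σ₁) + π₂ N_p(μ₂, Σ₂)` of the test point. -/
def mix : Measure (Fin p → ℝ) :=
  ENNReal.ofReal θ.prior1 • gaussMeasure p θ.mu1 θ.cov1
    + ENNReal.ofReal θ.prior2 • gaussMeasure p θ.mu2 θ.cov2

end QDAParam

/-- Classification error `R_θ(G) = P_θ(G(z) ≠ L(z))` of a classifier `G`. -/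
def Rerr {p : ℕ} (θ : QDAParam p) (G : (Fin p → ℝ) → ℕ) : ℝ :=
  θ.prior1 * (gaussMeasure p θ.mu1 θ.cov1 {z | G z ≠ 1}).toReal
    + θ.prior2 * (gaussMeasure p θ.mu2 θ.cov2 {z | G z ≠ 2}).toReal

/-- The alternative loss `L_θ(G) = P_θ(G(z) ≠ G*_θ(z))`. -/
def Lloss {p : ℕ} (θ : QDAParam p) (G : (Fin p → ℝ) → ℕ) : ℝ :=
  (θ.mix {z | G z ≠ θ.oracle z}).toReal

/-- Training data: `n₁` samples from class 1 and `n₂` samples from class 2. -/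
abbrev TwoSamples (p n1 n2 : ℕ) := (Fin n1 → (Fin p → ℝ)) × (Fin n2 → (Fin p → ℝ))

/-- The distribution of the training data under `θ`. -/
def trainMeasure {p : ℕ} (θ : QDAParam p) (n1 n2 : ℕ) : Measure (TwoSamples p n1 n2) :=
  (Measure.pi fun _ : Fin n1 => gaussMeasure p θ.mu1 θ.cov1).prod
    (Measure.pi fun _ : Fin n2 => gaussMeasure p θ.mu2 θ.cov2)

/-- Expected excess risk `E[R_θ(Ĝ) - R_θ(G*_θ)]` of a data-driven rule `Ĝ`. -/
def excessRisk {p : ℕ} (θ : QDAParam p) (n1 n2 : ℕ)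
    (Ghat : TwoSamples p n1 n2 → (Fin p → ℝ) → ℕ) : ℝ :=
  ∫ s, (Rerr θ (Ghat s) - Rerr θ θ.oracle) ∂(trainMeasure θ n1 n2)

/-- All eigenvalues of the symmetric matrix `S` lie in `[M₁⁻¹, M₁]`,
expressed via quadratic forms. -/
def covBounded {p : ℕ} (M1 : ℝ) (S : Matrix (Fin p) (Fin p) ℝ) : Prop :=
  ∀ v : Fin p → ℝ,
    M1⁻¹ * (v ⬝ᵥ v) ≤ v ⬝ᵥ S.mulVec v ∧ v ⬝ᵥ S.mulVec v ≤ M1 * (v ⬝ᵥ v)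

/-- The density of `Q(z; θ)` (with `z ∼` the mixture) is bounded by `M₂` on `(-δ₀, δ₀)`. -/
def qDensityBounded {p : ℕ} (d0 M2 : ℝ) (θ : QDAParam p) : Prop :=
  ∀ x : ℝ, |x| < d0 → (θ.mix.map θ.Qdisc).rnDeriv volume x < ENNReal.ofReal M2

/-- The sparse QDA parameter space `Θ_p(s₁, s₂)`. -/
def InThetaSpace (p s1 s2 : ℕ) (M0 M1 d0 M2 c : ℝ) (θ : QDAParam p) : Prop :=
  θ.prior1 + θ.prior2 = 1 ∧
  c ≤ θ.prior1 ∧ θ.prior1 ≤ 1 - c ∧ c ≤ θ.prior2 ∧ θ.prior2 ≤ 1 - c ∧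
  θ.cov1.PosDef ∧ θ.cov2.PosDef ∧
  Set.ncard {ij : Fin p × Fin p | θ.Dmat ij.1 ij.2 ≠ 0} ≤ s1 ∧
  Set.ncard {i : Fin p | θ.beta i ≠ 0} ≤ s2 ∧
  frobNorm θ.Dmat ≤ M0 ∧ l2norm θ.beta ≤ M0 ∧
  covBounded M1 θ.cov1 ∧ covBounded M1 θ.cov2 ∧
  qDensityBounded d0 M2 θ

/-- Sample mean. -/
def sampleMean {p n : ℕ} (x : Fin n → (Fin p → ℝ)) : Fin p → ℝ :=
  fun j => (∑ i, x i j) / n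

/-- Sample covariance matrix. -/
def sampleCov {p n : ℕ} (x : Fin n → (Fin p → ℝ)) : Matrix (Fin p) (Fin p) ℝ :=
  fun j k => (∑ i, (x i j - sampleMean x j) * (x i k - sampleMean x k)) / n

/-- Feasibility of `D` in the constrained ℓ₁ program (3.3). -/
def DFeasible {p : ℕ} (lam : ℝ) (S1 S2 D : Matrix (Fin p) (Fin p) ℝ) : Prop :=
  matLinf ((1 / 2 : ℝ) • (S1 * D * S2) + (1 / 2 : ℝ) • (S2 * D * S1) - S1 + S2) ≤ lam

/-- `D` is a solution of the constrained ℓ₁-minimization program (3.3). -/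
def IsDEstimate {p : ℕ} (lam : ℝ) (S1 S2 D : Matrix (Fin p) (Fin p) ℝ) : Prop :=
  DFeasible lam S1 S2 D ∧ ∀ D', DFeasible lam S1 S2 D' → matL1 D ≤ matL1 D'

/-- Feasibility of `b` in the constrained ℓ₁ program (3.4). -/
def betaFeasible {p : ℕ} (lam : ℝ) (S2 : Matrix (Fin p) (Fin p) ℝ) (m1 m2 b : Fin p → ℝ) :
    Prop :=
  linfnorm (S2.mulVec b - m2 + m1) ≤ lam

/-- `b` is a solution of the constrained ℓ₁-minimization program (3.4). -/
def IsBetaEstimate {p : ℕ} (lam : ℝ) (S2 : Matrix (Fin p) (Fin p) ℝ) (m1 m2 b : Fin p → ℝ) :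
    Prop :=
  betaFeasible lam S2 m1 m2 b ∧ ∀ b', betaFeasible lam S2 m1 m2 b' → l1norm b ≤ l1norm b'

/-- The SDAR classification rule built from estimates of the unknown quantities. -/
def sdarRule {p : ℕ} (m1 m2 : Fin p → ℝ) (S1 D : Matrix (Fin p) (Fin p) ℝ)
    (b : Fin p → ℝ) (p1 p2 : ℝ) (z : Fin p → ℝ) : ℕ :=
  if (z - m1) ⬝ᵥ D.mulVec (z - m1) - 2 * (b ⬝ᵥ (z - (1 / 2 : ℝ) • (m1 + m2)))
      - Real.log (D * S1 + 1).det + Real.log (p1 / p2) ≤ 0 then 2 else 1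

end

open ProbabilityTheory in
lemma pinsker_aux {α : Type*} [MeasurableSpace α] (P Q : Measure α) [IsProbabilityMeasure P]
    [IsProbabilityMeasure Q] (hPQ : P ≪ Q) (hint : Integrable (llr P Q) P)
    {B : Set α} (hB : MeasurableSet B) :
    |P.real B - Q.real B| ≤ Real.sqrt (klDivergence P Q / 2) := by
  have key : ∀ l : ℝ, l * (P.real B - Q.real B) - l ^ 2 / 8 ≤ klDivergence P Q := by
    intro l
    set X : α → ℝ := B.indicator 1 with hX
    have hXm : Measurable X := measurable_one.indicator hB
    have hmem : ∀ x, X x ∈ Set.Icc (0 : ℝ) 1 := by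
      intro x
      by_cases hx : x ∈ B <;> simp [hX, hx]
    have hQX : ∫ x, X x ∂Q = Q.real B := integral_indicator_one hB
    have hPX : ∫ x, X x ∂P = P.real B := integral_indicator_one hB
    have hXP : Integrable X P := (integrable_const (1 : ℝ)).indicator hB
    have hsub := hasSubgaussianMGF_of_mem_Icc (μ := Q) (X := X) (a := 0) (b := 1)
      hXm.aemeasurable (ae_of_all _ hmem)
    rw [hQX] at hsub
    have hexp := hsub.integrable_exp_mul l
    have hmgf := hsub.mgf_le l
    set f : α → ℝ := fun x => l * (X x - Q.real B) with hf
    have hfP : Integrable f P := (hXP.sub (integrable_const _)).const_mul l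
    have h1 := integral_llr_tilted_right hPQ hfP hexp hint
    have hprob : IsProbabilityMeasure (Q.tilted f) := isProbabilityMeasure_tilted hexp
    have hac : P ≪ Q.tilted f := hPQ.trans (absolutelyContinuous_tilted hexp)
    have h2 := InformationTheory.integral_llr_add_sub_measure_univ_nonneg hac
      (integrable_llr_tilted_right hPQ hfP hint hexp)
    have hfi : ∫ x, f x ∂P = l * (P.real B - Q.real B) := by
      simp only [hf]
      rw [integral_const_mul, integral_sub hXP (integrable_const _), hPX]
      simp
    have h3 : Real.log (∫ x, Real.exp (f x) ∂Q) ≤ l ^ 2 / 8 := by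
      rw [← Real.log_exp (l ^ 2 / 8)]
      apply Real.log_le_log (integral_exp_pos hexp)
      refine hmgf.trans (le_of_eq ?_)
      congr 1
      simp
      ring
    have h4 : klDivergence P Q = ∫ x, llr P Q x ∂P := rfl
    simp at h2
    rw [h4]
    linarith
  have := key (4 * (P.real B - Q.real B))
  apply Real.le_sqrt_of_sq_le
  rw [sq_abs]
  nlinarith

lemma gauss_std (p : ℕ) :
    gaussMeasure p 0 1 = Measure.pi (fun _ : Fin p => ProbabilityTheory.gaussianReal 0 1) := by
  symm
  apply Measure.pi_eq
  intro s hs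
  have hpdf : ∀ x : Fin p → ℝ, gaussPdf p 0 1 x =
      ∏ i, ProbabilityTheory.gaussianPDFReal 0 1 (x i) := by
    intro x
    simp only [gaussPdf, ProbabilityTheory.gaussianPDFReal, Finset.prod_mul_distrib,
      ← Real.exp_sum]
    congr 1
    · simp only [det_one, Real.one_rpow, mul_one, prod_const, card_univ, Fintype.card_fin,
        NNReal.coe_one]
      rw [Real.sqrt_eq_rpow, ← Real.rpow_neg (by positivity), ← Real.rpow_natCast,
        ← Real.rpow_mul (by positivity)]
      congr 1
      ring
    · congr 1
      simp only [one_div, sub_zero, inv_one, one_mulVec, dotProduct, Finset.mul_sum,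
        NNReal.coe_one, mul_one]
      apply Finset.sum_congr rfl
      intros; ring
  have hi : ∀ i, Integrable (ProbabilityTheory.gaussianPDFReal 0 1) (volume.restrict (s i)) :=
    fun i => (ProbabilityTheory.integrable_gaussianPDFReal 0 1).restrict
  rw [gaussMeasure, withDensity_apply _ (MeasurableSet.univ_pi hs)]
  simp_rw [hpdf]
  rw [volume_pi, Measure.restrict_pi_pi,
    ← ofReal_integral_eq_lintegral_ofReal (Integrable.fintype_prod hi)
      (ae_of_all _ fun x => Finset.prod_nonneg fun i _ =>
        ProbabilityTheory.gaussianPDFReal_nonneg _ _ _),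
    integral_fintype_prod_eq_prod, ENNReal.ofReal_prod_of_nonneg]
  · apply Finset.prod_congr rfl
    intro i _
    rw [ProbabilityTheory.gaussianReal_apply_eq_integral _ one_ne_zero]
  · intro i _
    exact integral_nonneg fun x => ProbabilityTheory.gaussianPDFReal_nonneg _ _ _

lemma gaussPdf_cont (p : ℕ) (μ : Fin p → ℝ) (S : Matrix (Fin p) (Fin p) ℝ) :
    Continuous (gaussPdf p μ S) := by
  unfold gaussPdf
  fun_prop

open scoped MatrixOrder Matrix.Norms.L2Operator in
lemma posSemidef_factor {p : ℕ} {S : Matrix (Fin p) (Fin p) ℝ} (hS : S.PosSemidef) :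
    ∃ B : Matrix (Fin p) (Fin p) ℝ, S = Bᵀ * B := by
  obtain ⟨B, hB⟩ := CStarAlgebra.nonneg_iff_eq_star_mul_self.mp hS.nonneg
  refine ⟨B, ?_⟩
  rw [hB, star_eq_conjTranspose, conjTranspose_eq_transpose_of_trivial]

lemma gauss_map (p : ℕ) (μ : Fin p → ℝ) (S : Matrix (Fin p) (Fin p) ℝ) (hS : S.PosDef) :
    ∃ M : Matrix (Fin p) (Fin p) ℝ, gaussMeasure p μ S =
      (Measure.pi (fun _ : Fin p => ProbabilityTheory.gaussianReal 0 1)).map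
        (fun y => μ + M.mulVec y) := by
  obtain ⟨B, hB⟩ : ∃ B : Matrix (Fin p) (Fin p) ℝ, S = Bᵀ * B := by
    exact posSemidef_factor hS.posSemidef
  have hdet : S.det = B.det ^ 2 := by rw [hB, det_mul, det_transpose]; ring
  have hSpos := hS.det_pos
  have hBdet : B.det ≠ 0 := by
    intro h0; rw [hdet, h0] at hSpos; simp at hSpos
  refine ⟨Bᵀ, ?_⟩
  rw [← gauss_std]
  have hTm : Measurable (fun y => μ + Bᵀ.mulVec y) :=
    (by fun_prop : Continuous (fun y => μ + Bᵀ.mulVec y)).measurable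
  have hvol : (volume : Measure (Fin p → ℝ)).map (fun y => μ + Bᵀ.mulVec y) =
      ENNReal.ofReal |B.det|⁻¹ • volume := by
    have h1 := Real.map_matrix_volume_pi_eq_smul_volume_pi (M := Bᵀ) (by simpa using hBdet)
    have h2 : (fun y => μ + Bᵀ.mulVec y) = (fun y => μ + y) ∘ (toLin' Bᵀ) := by
      ext y; simp
    rw [h2, ← Measure.map_map (by fun_prop) (by fun_prop), h1, Measure.map_smul,
      map_add_left_eq_self]
    simp [abs_inv]
  have hpdf : ∀ y, gaussPdf p 0 1 y = |B.det| * gaussPdf p μ S (μ + Bᵀ.mulVec y) := by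
    intro y
    have hq : (Bᵀ *ᵥ y) ⬝ᵥ S⁻¹ *ᵥ (Bᵀ *ᵥ y) = y ⬝ᵥ y := by
      have hu : IsUnit B.det := isUnit_iff_ne_zero.mpr hBdet
      have hu' : IsUnit Bᵀ.det := by simpa using hu
      rw [hB, Matrix.mul_inv_rev, mulVec_mulVec, Matrix.mul_assoc, nonsing_inv_mul _ hu',
        Matrix.mul_one, dotProduct_mulVec, mulVec_transpose, vecMul_vecMul,
        mul_nonsing_inv _ hu, vecMul_one]
    have hd : S.det ^ (-(1 : ℝ) / 2) = |B.det|⁻¹ := by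
      rw [hdet, ← sq_abs, ← Real.rpow_natCast, ← Real.rpow_mul (abs_nonneg _)]
      norm_num
      rw [Real.rpow_neg_one]
    simp only [gaussPdf, add_sub_cancel_left, hq, hd]
    have : |B.det| ≠ 0 := by simpa using hBdet
    field_simp
    simp
  ext A hA
  rw [Measure.map_apply hTm hA, gaussMeasure, gaussMeasure, withDensity_apply _ hA,
    withDensity_apply _ (hTm hA)]
  have hm : Measurable fun x => ENNReal.ofReal |B.det| * ENNReal.ofReal (gaussPdf p μ S x) :=
    (gaussPdf_cont p μ S).measurable.ennreal_ofReal.const_mul _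
  have h3 := setLIntegral_map (μ := volume) hA hm hTm
  simp_rw [hpdf, ENNReal.ofReal_mul (abs_nonneg B.det)]
  rw [← h3, hvol, Measure.restrict_smul, lintegral_smul_measure,
    lintegral_const_mul _ (gaussPdf_cont p μ S).measurable.ennreal_ofReal, smul_eq_mul, ← mul_assoc,
    ← ENNReal.ofReal_mul (by positivity), inv_mul_cancel₀ (by simpa using hBdet)]
  simp

lemma gauss_prob (p : ℕ) (μ : Fin p → ℝ) (S : Matrix (Fin p) (Fin p) ℝ) (hS : S.PosDef) :
    IsProbabilityMeasure (gaussMeasure p μ S) := by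
  obtain ⟨M, hM⟩ := gauss_map p μ S hS
  rw [hM]
  exact Measure.isProbabilityMeasure_map
    (by fun_prop : Continuous (fun y => μ + M.mulVec y)).measurable.aemeasurable

lemma gauss_memLp (p : ℕ) (μ : Fin p → ℝ) (S : Matrix (Fin p) (Fin p) ℝ) (hS : S.PosDef)
    (i : Fin p) : MemLp (fun x : Fin p → ℝ => x i) 2 (gaussMeasure p μ S) := by
  obtain ⟨M, hM⟩ := gauss_map p μ S hS
  rw [hM, memLp_map_measure_iff (measurable_pi_apply i).aestronglyMeasurable
    (by fun_prop : Continuous (fun y => μ + M.mulVec y)).measurable.aemeasurable]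
  have h1 : ∀ j, MemLp (fun y : Fin p → ℝ => y j) 2
      (Measure.pi (fun _ : Fin p => ProbabilityTheory.gaussianReal 0 1)) := by
    intro j
    have h := ProbabilityTheory.memLp_id_gaussianReal (μ := 0) (v := 1) 2
    have hmp : MeasurePreserving (fun y : Fin p → ℝ => y j)
        (Measure.pi (fun _ : Fin p => ProbabilityTheory.gaussianReal 0 1))
        (ProbabilityTheory.gaussianReal 0 1) :=
      measurePreserving_eval (fun _ : Fin p => ProbabilityTheory.gaussianReal 0 1) j
    exact MemLp.comp_measurePreserving (p := 2) h hmp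
  have h2 : ((fun x : Fin p → ℝ => x i) ∘ fun y => μ + M.mulVec y) =
      fun y => μ i + ∑ j, M i j * y j := by
    ext y; simp [mulVec, dotProduct]
  rw [h2]
  have h3 : MemLp (fun y : Fin p → ℝ => ∑ j, M i j * y j) 2
      (Measure.pi (fun _ : Fin p => ProbabilityTheory.gaussianReal 0 1)) :=
    memLp_finsetSum _ fun j _ => (h1 j).const_mul (M i j)
  have h4 : MemLp (fun _ : Fin p → ℝ => μ i) 2
      (Measure.pi (fun _ : Fin p => ProbabilityTheory.gaussianReal 0 1)) := memLp_const _
  exact h4.add h3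

lemma gauss_quad (p : ℕ) (μ : Fin p → ℝ) (S : Matrix (Fin p) (Fin p) ℝ) (hS : S.PosDef)
    (m : Fin p → ℝ) (A : Matrix (Fin p) (Fin p) ℝ) :
    Integrable (fun x => (x - m) ⬝ᵥ A.mulVec (x - m)) (gaussMeasure p μ S) := by
  have := gauss_prob p μ S hS
  have h1 : ∀ i, MemLp (fun x : Fin p → ℝ => x i - m i) 2 (gaussMeasure p μ S) :=
    fun i => (gauss_memLp p μ S hS i).sub (memLp_const _)
  simp only [dotProduct, mulVec, Pi.sub_apply, Finset.mul_sum]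
  refine integrable_finsetSum _ fun i _ => integrable_finsetSum _ fun j _ => ?_
  have := ((h1 i).integrable_mul (h1 j)).const_mul (A i j)
  refine this.congr (ae_of_all _ fun x => ?_)
  simp only [Pi.mul_apply]
  ring

noncomputable def mixPdf {p : ℕ} (θ : QDAParam p) (x : Fin p → ℝ) : ℝ :=
  θ.prior1 * gaussPdf p θ.mu1 θ.cov1 x + θ.prior2 * gaussPdf p θ.mu2 θ.cov2 x

lemma gaussPdf_pos (p : ℕ) (μ : Fin p → ℝ) (S : Matrix (Fin p) (Fin p) ℝ) (hS : S.PosDef)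
    (x : Fin p → ℝ) : 0 < gaussPdf p μ S x := by
  have := hS.det_pos
  unfold gaussPdf
  positivity

lemma mixPdf_cont {p : ℕ} (θ : QDAParam p) : Continuous (mixPdf θ) := by
  have := gaussPdf_cont p θ.mu1 θ.cov1
  have := gaussPdf_cont p θ.mu2 θ.cov2
  unfold mixPdf
  fun_prop

lemma mixPdf_pos {p : ℕ} (θ : QDAParam p) (h1 : 0 < θ.prior1) (h2 : 0 < θ.prior2)
    (hS1 : θ.cov1.PosDef) (hS2 : θ.cov2.PosDef) (x : Fin p → ℝ) : 0 < mixPdf θ x := by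
  have := gaussPdf_pos p θ.mu1 θ.cov1 hS1 x
  have := gaussPdf_pos p θ.mu2 θ.cov2 hS2 x
  unfold mixPdf
  positivity

lemma mix_eq {p : ℕ} (θ : QDAParam p) (h1 : 0 < θ.prior1) (h2 : 0 < θ.prior2)
    (hS1 : θ.cov1.PosDef) (hS2 : θ.cov2.PosDef) : θ.mix = volume.withDensity fun x => ENNReal.ofReal (mixPdf θ x) := by
  have m1 := (gaussPdf_cont p θ.mu1 θ.cov1).measurable.ennreal_ofReal
  have m2 := (gaussPdf_cont p θ.mu2 θ.cov2).measurable.ennreal_ofReal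
  rw [QDAParam.mix, gaussMeasure, gaussMeasure, ← withDensity_smul _ m1, ← withDensity_smul _ m2,
    ← withDensity_add_left (m1.const_smul _)]
  congr 1
  ext x
  have := gaussPdf_pos p θ.mu1 θ.cov1 hS1 x
  have := gaussPdf_pos p θ.mu2 θ.cov2 hS2 x
  simp only [Pi.add_apply, Pi.smul_apply, smul_eq_mul, mixPdf]
  rw [ENNReal.ofReal_add (by positivity) (by positivity), ENNReal.ofReal_mul h1.le,
    ENNReal.ofReal_mul h2.le]

lemma mix_prob {p : ℕ} (θ : QDAParam p) (h1 : 0 < θ.prior1) (h2 : 0 < θ.prior2)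
    (hS1 : θ.cov1.PosDef) (hS2 : θ.cov2.PosDef) (hsum : θ.prior1 + θ.prior2 = 1) : IsProbabilityMeasure θ.mix := by
  have := gauss_prob p θ.mu1 θ.cov1 hS1
  have := gauss_prob p θ.mu2 θ.cov2 hS2
  constructor
  simp [QDAParam.mix]
  rw [← ENNReal.ofReal_add h1.le h2.le, hsum, ENNReal.ofReal_one]

lemma mix_quad {p : ℕ} (θ : QDAParam p) (h1 : 0 < θ.prior1) (h2 : 0 < θ.prior2)
    (hS1 : θ.cov1.PosDef) (hS2 : θ.cov2.PosDef) (m : Fin p → ℝ) (A : Matrix (Fin p) (Fin p) ℝ) :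
    Integrable (fun x => (x - m) ⬝ᵥ A.mulVec (x - m)) θ.mix := by
  refine Integrable.add_measure ?_ ?_
  · exact (gauss_quad p _ _ hS1 m A).smul_measure ENNReal.ofReal_ne_top
  · exact (gauss_quad p _ _ hS2 m A).smul_measure ENNReal.ofReal_ne_top

lemma log_mix_bound {p : ℕ} (θ : QDAParam p) (h1 : 0 < θ.prior1) (h2 : 0 < θ.prior2)
    (hS1 : θ.cov1.PosDef) (hS2 : θ.cov2.PosDef) : ∃ C : ℝ, ∀ x, |Real.log (mixPdf θ x)| ≤
    C + (1 / 2) * ((x - θ.mu1) ⬝ᵥ θ.cov1⁻¹.mulVec (x - θ.mu1)) := by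
  have hq : ∀ (μ : Fin p → ℝ) (S : Matrix (Fin p) (Fin p) ℝ), S.PosDef → ∀ x : Fin p → ℝ,
      0 ≤ (x - μ) ⬝ᵥ S⁻¹.mulVec (x - μ) := by
    intro μ S hS x
    simpa using hS.inv.posSemidef.dotProduct_mulVec_nonneg (x - μ)
  have d1 := hS1.det_pos
  have d2 := hS2.det_pos
  obtain ⟨k1, hk1, e1⟩ : ∃ k : ℝ, 0 < k ∧ ∀ x, gaussPdf p θ.mu1 θ.cov1 x = k *
      Real.exp (-(1 / 2) * ((x - θ.mu1) ⬝ᵥ θ.cov1⁻¹.mulVec (x - θ.mu1))) :=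
    ⟨(2 * Real.pi) ^ (-(p : ℝ) / 2) * θ.cov1.det ^ (-(1 : ℝ) / 2), by positivity, fun x => rfl⟩
  obtain ⟨k2, hk2, e2⟩ : ∃ k : ℝ, 0 < k ∧ ∀ x, gaussPdf p θ.mu2 θ.cov2 x = k *
      Real.exp (-(1 / 2) * ((x - θ.mu2) ⬝ᵥ θ.cov2⁻¹.mulVec (x - θ.mu2))) :=
    ⟨(2 * Real.pi) ^ (-(p : ℝ) / 2) * θ.cov2.det ^ (-(1 : ℝ) / 2), by positivity, fun x => rfl⟩
  refine ⟨|Real.log (θ.prior1 * k1 + θ.prior2 * k2)| + |Real.log (θ.prior1 * k1)|, fun x => ?_⟩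
  have q1 := hq θ.mu1 θ.cov1 hS1 x
  have q2 := hq θ.mu2 θ.cov2 hS2 x
  have hpos := mixPdf_pos θ h1 h2 hS1 hS2 x
  have hp2 := gaussPdf_pos p θ.mu2 θ.cov2 hS2 x
  have up : mixPdf θ x ≤ θ.prior1 * k1 + θ.prior2 * k2 := by
    unfold mixPdf
    rw [e1, e2]
    have a1 : Real.exp (-(1 / 2) * ((x - θ.mu1) ⬝ᵥ θ.cov1⁻¹.mulVec (x - θ.mu1))) ≤ 1 := by
      apply Real.exp_le_one_iff.mpr; linarith
    have a2 : Real.exp (-(1 / 2) * ((x - θ.mu2) ⬝ᵥ θ.cov2⁻¹.mulVec (x - θ.mu2))) ≤ 1 := by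
      apply Real.exp_le_one_iff.mpr; linarith
    have b1 := mul_le_of_le_one_right hk1.le a1
    have b2 := mul_le_of_le_one_right hk2.le a2
    gcongr
  have lo : θ.prior1 * k1 * Real.exp (-(1 / 2) * ((x - θ.mu1) ⬝ᵥ θ.cov1⁻¹.mulVec (x - θ.mu1)))
      ≤ mixPdf θ x := by
    unfold mixPdf
    rw [e1]
    have : 0 < θ.prior2 * gaussPdf p θ.mu2 θ.cov2 x := by positivity
    linarith
  have lup := Real.log_le_log hpos up
  have llo := Real.log_le_log (by positivity) lo
  rw [Real.log_mul (by positivity) (by positivity), Real.log_exp] at llo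
  have c1 := le_abs_self (Real.log (θ.prior1 * k1 + θ.prior2 * k2))
  have c2 := neg_abs_le (Real.log (θ.prior1 * k1))
  have c3 := abs_nonneg (Real.log (θ.prior1 * k1 + θ.prior2 * k2))
  have c4 := abs_nonneg (Real.log (θ.prior1 * k1))
  rw [abs_le]
  constructor <;> linarith

lemma mix_llr {p : ℕ} (θ η : QDAParam p) (h1 : 0 < θ.prior1) (h2 : 0 < θ.prior2)
    (hS1 : θ.cov1.PosDef) (hS2 : θ.cov2.PosDef) (hsum : θ.prior1 + θ.prior2 = 1)
    (g1 : 0 < η.prior1) (g2 : 0 < η.prior2)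
    (hT1 : η.cov1.PosDef) (hT2 : η.cov2.PosDef) (gsum : η.prior1 + η.prior2 = 1) :
    θ.mix ≪ η.mix ∧ Integrable (llr θ.mix η.mix) θ.mix := by
  have hP := mix_prob θ h1 h2 hS1 hS2 hsum
  have hQ := mix_prob η g1 g2 hT1 hT2 gsum
  have fpos := mixPdf_pos θ h1 h2 hS1 hS2
  have gpos := mixPdf_pos η g1 g2 hT1 hT2
  have fm := (mixPdf_cont θ).measurable
  have gm := (mixPdf_cont η).measurable
  have rm : Measurable fun x => ENNReal.ofReal (mixPdf θ x / mixPdf η x) :=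
    (fm.div gm).ennreal_ofReal
  have heq : θ.mix = η.mix.withDensity fun x => ENNReal.ofReal (mixPdf θ x / mixPdf η x) := by
    rw [mix_eq θ h1 h2 hS1 hS2, mix_eq η g1 g2 hT1 hT2, ← withDensity_mul _ gm.ennreal_ofReal rm]
    congr 1
    ext x
    rw [Pi.mul_apply, ← ENNReal.ofReal_mul (gpos x).le, mul_div_cancel₀ _ (gpos x).ne']
  have hac : θ.mix ≪ η.mix := by
    rw [heq]; exact withDensity_absolutelyContinuous _ _
  refine ⟨hac, ?_⟩
  have hrn : θ.mix.rnDeriv η.mix =ᵐ[θ.mix]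
      fun x => ENNReal.ofReal (mixPdf θ x / mixPdf η x) := by
    apply hac.ae_eq
    conv_lhs => rw [heq]
    exact Measure.rnDeriv_withDensity _ rm
  obtain ⟨C, hC⟩ := log_mix_bound θ h1 h2 hS1 hS2
  obtain ⟨K, hK⟩ := log_mix_bound η g1 g2 hT1 hT2
  have hdom := ((integrable_const (μ := θ.mix) C).add
    ((mix_quad θ h1 h2 hS1 hS2 θ.mu1 θ.cov1⁻¹).const_mul (1 / 2))).add
    ((integrable_const (μ := θ.mix) K).add
    ((mix_quad θ h1 h2 hS1 hS2 η.mu1 η.cov1⁻¹).const_mul (1 / 2)))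
  have hi : Integrable (fun x => Real.log (mixPdf θ x) - Real.log (mixPdf η x)) θ.mix := by
    refine hdom.mono' (fm.log.sub gm.log).aestronglyMeasurable (ae_of_all _ fun x => ?_)
    rw [Real.norm_eq_abs]
    exact (abs_sub _ _).trans (add_le_add (hC x) (hK x))
  refine hi.congr ?_
  filter_upwards [hrn] with x hx
  rw [llr, hx, ENNReal.toReal_ofReal (div_nonneg (fpos x).le (gpos x).le),
    Real.log_div (fpos x).ne' (gpos x).ne']

/-- Lemma 8.1 (Azizyan et al.): approximate triangle inequality for the alternative loss
`L_θ` in terms of the KL divergence between the two mixture distributions. -/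
theorem statement8 (M0 M1 d0 M2 c : ℝ) (hM0 : 0 < M0) (hM1 : 1 < M1) (hd0 : 0 < d0)
    (hM2 : 0 < M2) (hc : 0 < c) (hc' : c < 1 / 2)
    (p s1 s2 : ℕ) (θ θt : QDAParam p)
    (hθ : InThetaSpace p s1 s2 M0 M1 d0 M2 c θ)
    (hθt : InThetaSpace p s1 s2 M0 M1 d0 M2 c θt)
    (G : (Fin p → ℝ) → ℕ)
    (h : Lloss θ θt.oracle + Lloss θ G + Real.sqrt (klDivergence θ.mix θt.mix / 2) ≤ 1 / 2) :
    Lloss θ θt.oracle - Lloss θ G - Real.sqrt (klDivergence θ.mix θt.mix / 2) ≤ Lloss θt G ∧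
    Lloss θt G ≤ Lloss θ θt.oracle + Lloss θ G + Real.sqrt (klDivergence θ.mix θt.mix / 2) := by

  obtain ⟨hsum, ha, -, hb, -, hS1, hS2, -⟩ := hθ
  obtain ⟨gsum, ga, -, gb, -, hT1, hT2, -⟩ := hθt
  have h1 := hc.trans_le ha
  have h2 := hc.trans_le hb
  have g1 := hc.trans_le ga
  have g2 := hc.trans_le gb
  have hP := mix_prob θ h1 h2 hS1 hS2 hsum
  have hQ := mix_prob θt g1 g2 hT1 hT2 gsum
  obtain ⟨hac, hint⟩ := mix_llr θ θt h1 h2 hS1 hS2 hsum g1 g2 hT1 hT2 gsum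
  have pin := fun (B : Set (Fin p → ℝ)) (hB : MeasurableSet B) =>
    abs_le.mp (pinsker_aux θ.mix θt.mix hac hint hB)
  set R := Real.sqrt (klDivergence θ.mix θt.mix / 2)
  -- comparison of outer measures of arbitrary sets
  have cmp1 : ∀ A : Set (Fin p → ℝ), θt.mix.real A ≤ θ.mix.real A + R := by
    intro A
    have e : θ.mix.real (toMeasurable θ.mix A) = θ.mix.real A := by
      simp [Measure.real, measure_toMeasurable]
    have l := measureReal_mono (μ := θt.mix) (subset_toMeasurable θ.mix A)
    have := (pin _ (measurableSet_toMeasurable θ.mix A)).1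
    linarith
  have cmp2 : ∀ A : Set (Fin p → ℝ), θ.mix.real A ≤ θt.mix.real A + R := by
    intro A
    have e : θt.mix.real (toMeasurable θt.mix A) = θt.mix.real A := by
      simp [Measure.real, measure_toMeasurable]
    have l := measureReal_mono (μ := θ.mix) (subset_toMeasurable θt.mix A)
    have := (pin _ (measurableSet_toMeasurable θt.mix A)).2
    linarith
  have e1 : Lloss θ θt.oracle = θ.mix.real {z | θt.oracle z ≠ θ.oracle z} := rfl
  have e2 : Lloss θ G = θ.mix.real {z | G z ≠ θ.oracle z} := rfl
  have e3 : Lloss θt G = θt.mix.real {z | G z ≠ θt.oracle z} := rfl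
  rw [e1, e2, e3]
  constructor
  · have s : {z | θt.oracle z ≠ θ.oracle z} ⊆
        {z | G z ≠ θ.oracle z} ∪ {z | G z ≠ θt.oracle z} := by
      intro z hz
      simp only [Set.mem_union, Set.mem_ofPred_eq] at hz ⊢
      by_contra! hcon
      exact hz (hcon.2.symm.trans hcon.1)
    have := (measureReal_mono (μ := θ.mix) s).trans (measureReal_union_le _ _)
    have := cmp2 {z | G z ≠ θt.oracle z}
    linarith
  · have s : {z | G z ≠ θt.oracle z} ⊆
        {z | θt.oracle z ≠ θ.oracle z} ∪ {z | G z ≠ θ.oracle z} := by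
      intro z hz
      simp only [Set.mem_union, Set.mem_ofPred_eq] at hz ⊢
      by_contra! hcon
      exact hz (hcon.2.trans hcon.1.symm)
    have := (measureReal_mono (μ := θ.mix) s).trans (measureReal_union_le _ _)
    have := cmp1 {z | G z ≠ θt.oracle z}
    linarith
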